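/- Let ι : ℍ² → ℍⁿ be a quasi-isometric embedding, let S ⊆ ∂_∞ℍⁿ be the image of the induced boundary map ∂ι : S¹ → ∂_∞ℍⁿ, and let K = CH(S) be the convex hull of S. Then for all d large enough, there exists a Lipschitz map f : N_d(K) → ℍ² such that sup_{x ∈ ℍ²} dist(f(ι(x)), x) < ∞. -/

import Mathlib

/-!
Common abstract framework.

Mathlib does not yet contain Riemannian geometry (sectional curvature, harmonic
maps, tension fields, Laplace–Beltrami operators, heat kernels, boundaries at
infinity, ...).  We therefore axiomatize a pinched Hadamard manifold by its
metric data (unique geodesics together with the median comparison inequalities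
characterizing the curvature bounds `-b² ≤ K ≤ -a²`), model real hyperbolic
`n`-space concretely by the hyperboloid model, and supply the genuinely
differential-geometric operators (smoothness, derivative/Hessian norms, tension
fields, harmonicity, Laplacian, Green's function, heat kernel, boundary at
infinity) as abstract data in explicit structures.
-/

noncomputable section

open Metric Set
open scoped ENNReal NNReal

/-- `f : X → Y` is a quasi-isometric embedding: for some constants `Λ ≥ 1`, `c ≥ 0`,
`Λ⁻¹ d(x,x') - c ≤ d(f x, f x') ≤ Λ d(x,x') + c` for all `x, x'`. -/
def QuasiIsometricEmbedding {X Y : Type*} [PseudoMetricSpace X] [PseudoMetricSpace Y]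
    (f : X → Y) : Prop :=
  ∃ Λ c : ℝ, 1 ≤ Λ ∧ 0 ≤ c ∧ ∀ x x' : X,
    Λ⁻¹ * dist x x' - c ≤ dist (f x) (f x') ∧ dist (f x) (f x') ≤ Λ * dist x x' + c

/-- The isometry group of `M` acts on `M` with cobounded orbits. -/
def CoboundedIsomOrbits (M : Type*) [MetricSpace M] : Prop :=
  ∃ C : ℝ, ∀ x y : M, ∃ γ : M ≃ᵢ M, dist (γ x) y ≤ C

/-- Geodesic convexity of a subset of a (uniquely geodesic) metric space: `C` contains,
with any two of its points, every point metrically between them. -/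
def GeodConvex {M : Type*} [MetricSpace M] (C : Set M) : Prop :=
  ∀ ⦃x⦄, x ∈ C → ∀ ⦃y⦄, y ∈ C → ∀ ⦃z⦄, dist x z + dist z y = dist x y → z ∈ C

/-- `r` is the nearest-point retraction onto `K`: `r x` lies in `K` and realizes the
distance from `x` to `K`. -/
def IsNearestPointRetraction {M : Type*} [MetricSpace M] (K : Set M) (r : M → M) : Prop :=
  ∀ x, r x ∈ K ∧ dist x (r x) = infDist x K

/-- `T` is an `r`-separated subset: distinct points of `T` are at distance at least `r`. -/
def SeparatedSet {M : Type*} [MetricSpace M] (r : ℝ) (T : Set M) : Prop :=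
  ∀ ⦃x⦄, x ∈ T → ∀ ⦃y⦄, y ∈ T → x ≠ y → r ≤ dist x y

/-- The induced path (pseudo-)metric on a subset `Z ⊆ M`: the infimum of the lengths
(total variations) of continuous paths joining `x` to `y` inside `Z` (`∞` if there is
no such path of finite length). -/
def pathDist {M : Type*} [MetricSpace M] (Z : Set M) (x y : M) : ℝ≥0∞ :=
  ⨅ (γ : ℝ → M) (_ : ContinuousOn γ (Icc 0 1)) (_ : MapsTo γ (Icc 0 1) Z)
    (_ : γ 0 = x) (_ : γ 1 = y), eVariationOn γ (Icc 0 1)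

/-- Inverse hyperbolic cosine. -/
def arcosh (x : ℝ) : ℝ := Real.log (x + Real.sqrt (x ^ 2 - 1))

/-- The Minkowski bilinear form of signature `(n,1)` on `ℝ^{n+1}`. -/
def mink (n : ℕ) (x y : Fin (n + 1) → ℝ) : ℝ :=
  (∑ i : Fin n, x i.succ * y i.succ) - x 0 * y 0

/-- The hyperboloid model of real hyperbolic `n`-space. -/
def Hyperboloid (n : ℕ) : Type :=
  {x : Fin (n + 1) → ℝ // mink n x x = -1 ∧ 0 < x 0}

/-- The hyperbolic distance (for constant curvature `-1`) in the hyperboloid model. -/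
def hypDist {n : ℕ} (p q : Hyperboloid n) : ℝ :=
  arcosh (-(mink n p.1 q.1))

/-- A metric space `H` *is real hyperbolic `n`-space* `ℍⁿ` (of constant curvature `-1`)
if it is isometric to the hyperboloid model with the hyperbolic distance. -/
def IsHyperbolicSpace (n : ℕ) (H : Type*) [MetricSpace H] : Prop :=
  ∃ e : H ≃ Hyperboloid n, ∀ p q : H, dist p q = hypDist (e p) (e q)

/-- Metric axiomatization of a *pinched Hadamard manifold* of dimension `n` with
sectional curvature bounds `-b² ≤ K ≤ -a²`, `0 < a ≤ b`: a nonempty complete, simply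
connected, uniquely geodesic metric space in which the median (Bruhat–Tits type)
comparison inequalities with the model planes of constant curvature `-a²` and `-b²`
hold (these express the two-sided curvature pinching in purely metric terms).
The parameter `n` records the dimension of the manifold. -/
structure PinchedHadamardSpace (n : ℕ) (a b : ℝ) : Type 1 where
  pos_a : 0 < a
  a_le_b : a ≤ b
  /-- the underlying space -/
  M : Type
  [met : MetricSpace M]
  [nonempty : Nonempty M]
  [complete : CompleteSpace M]
  [simplyConnected : SimplyConnectedSpace M]
  /-- `geod x y t` is the point at parameter `t ∈ [0,1]` of the geodesic from `x` to `y` -/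
  geod : M → M → ℝ → M
  geod_zero : ∀ x y, geod x y 0 = x
  geod_one : ∀ x y, geod x y 1 = y
  geod_dist : ∀ x y : M, ∀ s ∈ Icc (0:ℝ) 1, ∀ t ∈ Icc (0:ℝ) 1,
    dist (geod x y s) (geod x y t) = |s - t| * dist x y
  /-- curvature `≤ -a²`: CAT(-a²) median comparison inequality -/
  comp_upper : ∀ x y z : M,
    Real.cosh (a * dist x (geod y z (1/2))) * Real.cosh (a * dist y z / 2) ≤
      (Real.cosh (a * dist x y) + Real.cosh (a * dist x z)) / 2
  /-- curvature `≥ -b²`: reverse median comparison inequality -/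
  comp_lower : ∀ x y z : M,
    (Real.cosh (b * dist x y) + Real.cosh (b * dist x z)) / 2 ≤
      Real.cosh (b * dist x (geod y z (1/2))) * Real.cosh (b * dist y z / 2)

attribute [instance] PinchedHadamardSpace.met PinchedHadamardSpace.nonempty
  PinchedHadamardSpace.complete PinchedHadamardSpace.simplyConnected

/-- Abstract data of the boundary at infinity `∂_∞M` of a Hadamard manifold `M`:
the set `pt` of boundary points, the bi-infinite geodesic `geo y z ⊆ M` joining two
boundary points, the induced action `act` of the isometry group on the boundary,
geodesic rays `ray x ζ` from an interior point to a boundary point, the radial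
projection `proj x w ∈ ∂_∞M` of `w ≠ x` from `x`, and convergence of sequences
in `M` to boundary points. -/
structure BoundaryAtInfinity (M : Type) [MetricSpace M] : Type 1 where
  /-- the set of points at infinity -/
  pt : Type
  /-- the union of the images of the geodesics joining two boundary points -/
  geo : pt → pt → Set M
  geo_symm : ∀ y z, geo y z = geo z y
  /-- the induced boundary action of the isometry group -/
  act : (M ≃ᵢ M) → pt → pt
  act_geo : ∀ (γ : M ≃ᵢ M) (y z : pt), geo (act γ y) (act γ z) = γ '' geo y z
  /-- the geodesic ray from `x ∈ M` to a boundary point `ζ` -/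
  ray : M → pt → Set M
  ray_base : ∀ x ζ, x ∈ ray x ζ
  /-- `proj x w` is the endpoint at infinity of the geodesic ray from `x` through `w ≠ x` -/
  proj : M → M → pt
  proj_mem : ∀ x w : M, x ≠ w → w ∈ ray x (proj x w)
  /-- convergence of a sequence in `M` to a point at infinity -/
  conv : (ℕ → M) → pt → Prop

namespace BoundaryAtInfinity

variable {M : Type} [MetricSpace M] (B : BoundaryAtInfinity M)

/-- `GH S`: the union of all bi-infinite geodesics with both endpoints in `S ⊆ ∂_∞M`. -/
def GH (S : Set B.pt) : Set M := ⋃ y ∈ S, ⋃ z ∈ S, B.geo y z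

/-- `CH S`: the convex hull of `S ⊆ ∂_∞M`, i.e. the intersection of all (geodesically)
convex subsets of `M` containing all geodesics with endpoints in `S`. -/
def CH (S : Set B.pt) : Set M := ⋂₀ {C : Set M | GeodConvex C ∧ B.GH S ⊆ C}

/-- `cone x T`: the union of the geodesic rays from `x` with endpoint at infinity in `T`. -/
def cone (x : M) (T : Set B.pt) : Set M := ⋃ ζ ∈ T, B.ray x ζ

open Classical in
/-- The visual metric on `∂_∞M` with parameter `a` based at `o`, in the normalized
form `dist_o^vis(y,z) = e^{-a · dist(o,[y,z])}` (a representative of its bi-Lipschitz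
equivalence class). -/
def visDist (a : ℝ) (o : M) (y z : B.pt) : ℝ :=
  if y = z then 0 else Real.exp (-(a * infDist o (B.geo y z)))

/-- The ball of radius `ε` about `y` for the visual metric based at `o`. -/
def visBall (a : ℝ) (o : M) (y : B.pt) (ε : ℝ) : Set B.pt :=
  {z : B.pt | B.visDist a o y z < ε}

/-- The *invariant upper Minkowski dimension* of `S ⊆ ∂_∞M` is `< β`:  there is some
`d < β` and a constant `C > 0` such that for every isometry `γ` of `M` and every
`0 < ε ≤ 1`, the set `γS` can be covered by at most `C ε^{-d}` balls of radius `ε`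
for the visual metric based at `o`. -/
def InvMinkDimLT (a : ℝ) (o : M) (S : Set B.pt) (β : ℝ) : Prop :=
  ∃ d : ℝ, 0 ≤ d ∧ d < β ∧ ∃ C : ℝ, 0 < C ∧
    ∀ (γ : M ≃ᵢ M) (ε : ℝ), 0 < ε → ε ≤ 1 →
      ∃ F : Finset B.pt, (F.card : ℝ) ≤ C * ε ^ (-d) ∧
        B.act γ '' S ⊆ ⋃ y ∈ F, B.visBall a o y ε

/-- `S ⊆ ∂_∞M` is closed (for the visual metric based at `o`). -/
def IsClosedBdry (a : ℝ) (o : M) (S : Set B.pt) : Prop :=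
  ∀ z : B.pt, (∀ ε > 0, ∃ y ∈ S, B.visDist a o y z < ε) → z ∈ S

end BoundaryAtInfinity

/-- Abstract differential-geometric data for maps between two Riemannian manifolds
(with underlying spaces `M`, `N`): the predicates "`f` is smooth" and "`f` is `C²` on
a set", the pointwise operator norm `derivNorm f x = ‖∇ₓf‖` of the derivative, the
pointwise norm `hessNorm f x = sup_{‖X‖ ≤ 1} ‖H(f)ₓ(X,X)‖` of the Hessian (second
fundamental form), the pointwise norm `tensionNorm f x = ‖τ(f)(x)‖` of the tension
field, and the predicate "`f` is harmonic", which holds iff `f` is smooth with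
vanishing tension field. -/
structure SmoothMapData (M N : Type) : Type 1 where
  Smooth : (M → N) → Prop
  C2On : (M → N) → Set M → Prop
  derivNorm : (M → N) → M → ℝ
  hessNorm : (M → N) → M → ℝ
  tensionNorm : (M → N) → M → ℝ
  Harmonic : (M → N) → Prop
  harmonic_iff : ∀ f, Harmonic f ↔ Smooth f ∧ ∀ x, tensionNorm f x = 0

/-- Abstract data of the Laplace–Beltrami operator acting on real valued functions on
a Riemannian manifold with underlying space `M`: smoothness of a function at a point,
the Laplacian `lap`, and the pointwise norm of the gradient. -/
structure LaplaceData (M : Type) : Type 1 where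
  SmoothAt : (M → ℝ) → M → Prop
  lap : (M → ℝ) → M → ℝ
  gradNorm : (M → ℝ) → M → ℝ

/-- Abstract data of the Riemannian volume and the Green's function of (the negative
of) the Laplacian of a Riemannian manifold with underlying space `M`:  `green` is
symmetric, nonnegative, and inverts `-Δ`. -/
structure GreenData (M : Type) [MetricSpace M] [MeasurableSpace M] (L : LaplaceData M) :
    Type 1 where
  /-- the Riemannian volume measure -/
  vol : MeasureTheory.Measure M
  /-- the Green's function -/
  green : M → M → ℝ
  green_nonneg : ∀ x y, 0 ≤ green x y
  green_symm : ∀ x y, green x y = green y x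
  green_spec : ∀ u : M → ℝ, Continuous u → HasCompactSupport u →
    ∀ x, L.lap (fun x' => ∫ y, green x' y * u y ∂vol) x = -u x

/-- Abstract data of the Riemannian volume and the heat kernel of a Riemannian
manifold with underlying space `M`: `heat x y t` is symmetric, nonnegative, satisfies
the Chapman–Kolmogorov identity and is sub-Markovian. -/
structure HeatKernelData (M : Type) [MetricSpace M] [MeasurableSpace M] : Type 1 where
  /-- the Riemannian volume measure -/
  vol : MeasureTheory.Measure M
  /-- the heat kernel -/
  heat : M → M → ℝ → ℝ
  heat_nonneg : ∀ x y t, 0 ≤ heat x y t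
  heat_symm : ∀ x y t, heat x y t = heat y x t
  chapman : ∀ (x y : M) (s t : ℝ), 0 < s → 0 < t →
    ∫ z, heat x z s * heat z y t ∂vol = heat x y (s + t)
  subMarkov : ∀ (x : M) (t : ℝ), 0 < t → ∫ y, heat x y t ∂vol ≤ 1

/-! ### The hyperboloid model of the hyperbolic plane -/

theorem neg_mink_two (x y : Fin 3 → ℝ) :
    -mink 2 x y = x 0 * y 0 - x 1 * y 1 - x 2 * y 2 := by
  simp only [mink, Fin.sum_univ_two]
  change -(x 1 * y 1 + x 2 * y 2 - x 0 * y 0) = _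
  ring

theorem mink_two_comm (x y : Fin 3 → ℝ) : mink 2 x y = mink 2 y x := by
  have h1 := neg_mink_two x y
  have h2 := neg_mink_two y x
  linarith

namespace Hyperboloid

theorem sq_zero (x : Hyperboloid 2) : x.1 0 ^ 2 = 1 + x.1 1 ^ 2 + x.1 2 ^ 2 := by
  have h := neg_mink_two x.1 x.1
  rw [x.2.1] at h
  nlinarith

theorem zero_pos (x : Hyperboloid 2) : 0 < x.1 0 := x.2.2

theorem one_le_zero (x : Hyperboloid 2) : 1 ≤ x.1 0 := by
  have h := x.sq_zero
  nlinarith [x.zero_pos, sq_nonneg (x.1 1), sq_nonneg (x.1 2)]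

theorem zero_add_one_pos (x : Hyperboloid 2) : 0 < x.1 0 + x.1 1 := by
  have h := x.sq_zero
  have h0 := x.zero_pos
  nlinarith [sq_nonneg (x.1 2), sq_nonneg (x.1 0 + x.1 1)]

theorem abs_le_zero (x : Hyperboloid 2) (j : Fin 3) : |x.1 j| ≤ x.1 0 := by
  have h := x.sq_zero
  have h0 := x.zero_pos
  apply abs_le_of_sq_le_sq _ h0.le
  fin_cases j
  · exact le_rfl
  · change x.1 1 ^ 2 ≤ _
    nlinarith [sq_nonneg (x.1 2)]
  · change x.1 2 ^ 2 ≤ _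
    nlinarith [sq_nonneg (x.1 1)]

/-- The Minkowski pairing in the horospherical coordinates `u = x₀ + x₁`, `t = x₂`. -/
theorem neg_mink_eq (x y : Hyperboloid 2) :
    -mink 2 x.1 y.1 =
      ((x.1 0 + x.1 1) / (y.1 0 + y.1 1) + ((x.1 0 + x.1 1) / (y.1 0 + y.1 1))⁻¹ +
        (x.1 0 + x.1 1) * (y.1 0 + y.1 1) *
          (y.1 2 / (y.1 0 + y.1 1) - x.1 2 / (x.1 0 + x.1 1)) ^ 2) / 2 := by
  have hx := x.zero_add_one_pos
  have hy := y.zero_add_one_pos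
  have hx2 := x.sq_zero
  have hy2 := y.sq_zero
  rw [neg_mink_two]
  generalize x.1 0 = a at *
  generalize x.1 1 = b at *
  generalize x.1 2 = c at *
  generalize y.1 0 = a' at *
  generalize y.1 1 = b' at *
  generalize y.1 2 = c' at *
  have e1 : a - b = (1 + c ^ 2) / (a + b) := by
    rw [eq_div_iff hx.ne']; linarith
  have e2 : a' - b' = (1 + c' ^ 2) / (a' + b') := by
    rw [eq_div_iff hy.ne']; linarith
  have e3 : a * a' - b * b' - c * c' =
      ((a + b) * (a' - b') + (a' + b') * (a - b)) / 2 - c * c' := by ring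
  rw [e3, e1, e2]
  generalize a + b = u at *
  generalize a' + b' = u' at *
  field_simp
  ring

theorem one_le_neg_mink (x y : Hyperboloid 2) : 1 ≤ -mink 2 x.1 y.1 := by
  rw [neg_mink_eq]
  have hx := x.zero_add_one_pos
  have hy := y.zero_add_one_pos
  have hr := div_pos hx hy
  have h1 : 0 ≤ (x.1 0 + x.1 1) * (y.1 0 + y.1 1) *
      (y.1 2 / (y.1 0 + y.1 1) - x.1 2 / (x.1 0 + x.1 1)) ^ 2 := by positivity
  generalize (x.1 0 + x.1 1) / (y.1 0 + y.1 1) = r at *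
  have h2 : r + r⁻¹ - 2 = (r - 1) ^ 2 / r := by field_simp; ring
  have h3 : 0 ≤ (r - 1) ^ 2 / r := by positivity
  linarith

theorem cosh_hypDist (x y : Hyperboloid 2) : Real.cosh (hypDist x y) = -mink 2 x.1 y.1 :=
  Real.cosh_arcosh (one_le_neg_mink x y)

theorem hypDist_nonneg (x y : Hyperboloid 2) : 0 ≤ hypDist x y :=
  Real.arcosh_nonneg (one_le_neg_mink x y)

theorem hypDist_le {x y : Hyperboloid 2} {ε : ℝ} (hε : 0 ≤ ε)
    (h : -mink 2 x.1 y.1 ≤ Real.cosh ε) : hypDist x y ≤ ε := by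
  rw [← cosh_hypDist, Real.cosh_le_cosh, abs_of_nonneg (hypDist_nonneg x y),
    abs_of_nonneg hε] at h
  exact h

/-- The radial projection of a timelike vector of `ℝ^{2,1}` to the hyperboloid. -/
def normalize (v : Fin 3 → ℝ) (h : 0 < -mink 2 v v) (h0 : 0 < v 0) : Hyperboloid 2 :=
  ⟨fun j => v j / √(-mink 2 v v), by
    have hs : 0 < √(-mink 2 v v) := Real.sqrt_pos.2 h
    refine ⟨?_, div_pos h0 hs⟩
    have hq := Real.sq_sqrt h.le
    have h1 := neg_mink_two v v
    have h2 := neg_mink_two (fun j => v j / √(-mink 2 v v)) (fun j => v j / √(-mink 2 v v))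
    generalize √(-mink 2 v v) = s at *
    have h3 : v 0 / s * (v 0 / s) - v 1 / s * (v 1 / s) - v 2 / s * (v 2 / s) =
        (v 0 * v 0 - v 1 * v 1 - v 2 * v 2) / s ^ 2 := by
      field_simp
    rw [h3, ← h1, hq, div_self h.ne'] at h2
    linarith⟩

theorem neg_mink_normalize_left (v z : Fin 3 → ℝ) (h : 0 < -mink 2 v v) (h0 : 0 < v 0) :
    -mink 2 (normalize v h h0).1 z = -mink 2 v z / √(-mink 2 v v) := by
  rw [neg_mink_two, neg_mink_two v z]
  simp only [normalize]
  ring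

theorem neg_mink_normalize (v w : Fin 3 → ℝ) (hv : 0 < -mink 2 v v) (hv0 : 0 < v 0)
    (hw : 0 < -mink 2 w w) (hw0 : 0 < w 0) :
    -mink 2 (normalize v hv hv0).1 (normalize w hw hw0).1 =
      -mink 2 v w / (√(-mink 2 v v) * √(-mink 2 w w)) := by
  rw [neg_mink_normalize_left, mink_two_comm, neg_mink_normalize_left, mink_two_comm w v,
    div_div, mul_comm]

end Hyperboloid

/-! ### Weighted sums of points of the hyperboloid -/

section WeightedSum

variable {I : Type*} {Y : I → Hyperboloid 2} {c c' : I → ℝ}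

/-- The sum `∑ c i • Y i` in the ambient Minkowski space. -/
def hypSum (Y : I → Hyperboloid 2) (c : I → ℝ) : Fin 3 → ℝ :=
  fun j => ∑' i, c i * (Y i).1 j

/-- Nonnegative weights for which `hypSum Y c` converges absolutely. -/
def HypSummable (Y : I → Hyperboloid 2) (c : I → ℝ) : Prop :=
  (∀ i, 0 ≤ c i) ∧ Summable fun i => c i * (Y i).1 0

theorem HypSummable.coord (hc : HypSummable Y c) (j : Fin 3) :
    Summable fun i => c i * (Y i).1 j := by
  refine Summable.of_norm_bounded hc.2 fun i => ?_
  rw [Real.norm_eq_abs, abs_mul, abs_of_nonneg (hc.1 i)]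
  exact mul_le_mul_of_nonneg_left ((Y i).abs_le_zero j) (hc.1 i)

theorem HypSummable.summable (hc : HypSummable Y c) : Summable c := by
  refine Summable.of_nonneg_of_le hc.1 (fun i => ?_) hc.2
  exact le_mul_of_one_le_right (hc.1 i) (Y i).one_le_zero

theorem HypSummable.hasSum_neg_mink (hc : HypSummable Y c) (z : Fin 3 → ℝ) :
    HasSum (fun i => c i * -mink 2 (Y i).1 z) (-mink 2 (hypSum Y c) z) := by
  have h := (((hc.coord 0).hasSum.mul_right (z 0)).sub ((hc.coord 1).hasSum.mul_right (z 1))).sub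
    ((hc.coord 2).hasSum.mul_right (z 2))
  rw [neg_mink_two]
  refine h.congr_fun ?_
  intro i
  rw [neg_mink_two]
  ring

theorem HypSummable.tsum_le_neg_mink (hc : HypSummable Y c) (z : Hyperboloid 2) :
    ∑' i, c i ≤ -mink 2 (hypSum Y c) z.1 := by
  refine hasSum_le (fun i => ?_) hc.summable.hasSum (hc.hasSum_neg_mink z.1)
  exact le_mul_of_one_le_right (hc.1 i) ((Y i).one_le_neg_mink z)

theorem HypSummable.tsum_mul_tsum_le (hc : HypSummable Y c) (hc' : HypSummable Y c') :
    (∑' i, c i) * ∑' i, c' i ≤ -mink 2 (hypSum Y c) (hypSum Y c') := by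
  refine hasSum_le (fun i => ?_) (hc.summable.hasSum.mul_right _) (hc.hasSum_neg_mink _)
  refine mul_le_mul_of_nonneg_left ?_ (hc.1 i)
  rw [mink_two_comm]
  exact hc'.tsum_le_neg_mink (Y i)

theorem HypSummable.neg_mink_nonneg (hc : HypSummable Y c) (hc' : HypSummable Y c') :
    0 ≤ -mink 2 (hypSum Y c) (hypSum Y c') :=
  (mul_nonneg (tsum_nonneg hc.1) (tsum_nonneg hc'.1)).trans (hc.tsum_mul_tsum_le hc')

theorem HypSummable.tsum_le_sqrt (hc : HypSummable Y c) :
    ∑' i, c i ≤ √(-mink 2 (hypSum Y c) (hypSum Y c)) :=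
  Real.le_sqrt_of_sq_le (by rw [sq]; exact hc.tsum_mul_tsum_le hc)

theorem HypSummable.mono (hc : HypSummable Y c) (h0 : ∀ i, 0 ≤ c' i) (s : ℝ)
    (h : ∀ i, c' i ≤ s * c i) : HypSummable Y c' := by
  refine ⟨h0, Summable.of_nonneg_of_le (fun i => mul_nonneg (h0 i) (Y i).zero_pos.le)
    (fun i => ?_) (hc.2.mul_left s)⟩
  rw [← mul_assoc]
  exact mul_le_mul_of_nonneg_right (h i) (Y i).zero_pos.le

/-- Domination `c' ≤ s c` of weights forces `s ∑ c i • Y i - ∑ c' i • Y i` to be causal. -/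
theorem HypSummable.quadratic_nonneg (hc : HypSummable Y c) (hc' : HypSummable Y c') (s : ℝ)
    (h : ∀ i, c' i ≤ s * c i) :
    0 ≤ s ^ 2 * -mink 2 (hypSum Y c) (hypSum Y c) -
        2 * s * -mink 2 (hypSum Y c) (hypSum Y c') + -mink 2 (hypSum Y c') (hypSum Y c') ∧
      -mink 2 (hypSum Y c') (hypSum Y c') ≤ s ^ 2 * -mink 2 (hypSum Y c) (hypSum Y c) := by
  have hd : HypSummable Y fun i => s * c i - c' i :=
    hc.mono (fun i => sub_nonneg.2 (h i)) s fun i => sub_le_self _ (hc'.1 i)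
  have hsub : ∀ j, hypSum Y (fun i => s * c i - c' i) j =
      s * hypSum Y c j - hypSum Y c' j := by
    intro j
    refine HasSum.tsum_eq ?_
    refine (((hc.coord j).hasSum.mul_left s).sub (hc'.coord j).hasSum).congr_fun ?_
    intro i
    ring
  have h1 := hd.neg_mink_nonneg hd
  have h2 := hd.neg_mink_nonneg hc'
  simp only [neg_mink_two, hsub] at h1 h2 ⊢
  constructor
  · linarith
  · linarith

/-- The normalized weighted sum. -/
def hypBarycenter (Y : I → Hyperboloid 2) (c : I → ℝ) (hc : HypSummable Y c)
    (hpos : 0 < ∑' i, c i) : Hyperboloid 2 :=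
  Hyperboloid.normalize (hypSum Y c)
    ((mul_pos hpos hpos).trans_le (hc.tsum_mul_tsum_le hc))
    (hpos.trans_le (hasSum_le
      (fun i => le_mul_of_one_le_right (hc.1 i) (Y i).one_le_zero) hc.summable.hasSum hc.2.hasSum))

/-- The elementary inequality behind the contraction property of the barycenter. -/
theorem le_mul_add_inv {s a b B : ℝ} (hs : 0 < s) (ha : 0 < a) (hb : 0 < b)
    (hab : a ≤ b) (hba : b ^ 2 ≤ s ^ 2 * a ^ 2)
    (h : 0 ≤ s ^ 2 * a ^ 2 - 2 * s * B + b ^ 2) :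
    B ≤ (s + s⁻¹) / 2 * (a * b) := by
  have hbs : b ≤ s * a := by
    rw [← mul_pow] at hba
    exact le_of_sq_le_sq hba (by positivity)
  have hs1 : 1 ≤ s := by
    by_contra hlt
    nlinarith
  have key : 2 * s * B ≤ (s ^ 2 + 1) * (a * b) := by
    have : b ≤ s ^ 2 * a := by nlinarith [mul_nonneg (sub_nonneg.2 hs1) ha.le]
    nlinarith [mul_nonneg (sub_nonneg.2 hab) (sub_nonneg.2 this)]
  have e : (s + s⁻¹) / 2 * (a * b) = (s ^ 2 + 1) * (a * b) / (2 * s) := by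
    field_simp
  rw [e, le_div_iff₀ (by positivity)]
  linarith

/-- Weights that differ by factors in `[e^{-ε}, e^ε]` have barycenters at distance `≤ ε`. -/
theorem hypDist_hypBarycenter_le (hc : HypSummable Y c) (hc' : HypSummable Y c')
    (hpos : 0 < ∑' i, c i) (hpos' : 0 < ∑' i, c' i) {ε : ℝ} (hε : 0 ≤ ε)
    (h : ∀ i, c' i ≤ Real.exp ε * c i) (h' : ∀ i, c i ≤ Real.exp ε * c' i) :
    hypDist (hypBarycenter Y c hc hpos) (hypBarycenter Y c' hc' hpos') ≤ ε := by
  apply Hyperboloid.hypDist_le hε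
  rw [hypBarycenter, hypBarycenter, Hyperboloid.neg_mink_normalize]
  have ha := hpos.trans_le hc.tsum_le_sqrt
  have hb := hpos'.trans_le hc'.tsum_le_sqrt
  obtain ⟨q1, q2⟩ := hc.quadratic_nonneg hc' _ h
  obtain ⟨q3, q4⟩ := hc'.quadratic_nonneg hc _ h'
  rw [mink_two_comm (hypSum Y c') (hypSum Y c)] at q3
  have sa := Real.sq_sqrt (Real.sqrt_pos.1 ha).le
  have sb := Real.sq_sqrt (Real.sqrt_pos.1 hb).le
  rw [div_le_iff₀ (mul_pos ha hb), Real.cosh_eq, Real.exp_neg]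
  generalize √(-mink 2 (hypSum Y c) (hypSum Y c)) = a at *
  generalize √(-mink 2 (hypSum Y c') (hypSum Y c')) = b at *
  rw [← sa, ← sb] at q1 q2 q3 q4
  rcases le_total a b with hab | hab
  · exact le_mul_add_inv (Real.exp_pos ε) ha hb hab q2 q1
  · rw [mul_comm a b]
    exact le_mul_add_inv (Real.exp_pos ε) hb ha hab q4 q3

end WeightedSum

/-! ### A net in the hyperbolic plane -/

/-- The net of points with horospherical coordinates `u = 2^{-k}`, `t = m`. -/
def hypNet (i : ℤ × ℤ) : Hyperboloid 2 :=
  ⟨![((2 ^ i.1)⁻¹ + 2 ^ i.1 * (1 + (i.2 : ℝ) ^ 2)) / 2,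
    ((2 ^ i.1)⁻¹ - 2 ^ i.1 * (1 + (i.2 : ℝ) ^ 2)) / 2, (i.2 : ℝ)], by
    have hk : (0 : ℝ) < 2 ^ i.1 := by positivity
    constructor
    · rw [← neg_inj, neg_mink_two]
      simp only [Matrix.cons_val_zero, Matrix.cons_val_one, Matrix.cons_val]
      field_simp
      ring
    · simp only [Matrix.cons_val_zero]
      positivity⟩

theorem neg_mink_hypNet (i : ℤ × ℤ) (x : Hyperboloid 2) :
    -mink 2 (hypNet i).1 x.1 =
      ((x.1 0 + x.1 1) * 2 ^ i.1 + ((x.1 0 + x.1 1) * 2 ^ i.1)⁻¹ + (x.1 0 + x.1 1) * 2 ^ i.1 *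
        ((i.2 : ℝ) - x.1 2 / ((x.1 0 + x.1 1) * 2 ^ i.1)) ^ 2) / 2 := by
  have hk : (0 : ℝ) < 2 ^ i.1 := by positivity
  have hx := x.zero_add_one_pos
  have hu : (hypNet i).1 0 + (hypNet i).1 1 = (2 ^ i.1)⁻¹ := by
    simp only [hypNet, Matrix.cons_val_zero, Matrix.cons_val_one]
    ring
  have ht : (hypNet i).1 2 = i.2 := rfl
  rw [mink_two_comm, Hyperboloid.neg_mink_eq, hu, ht]
  generalize x.1 0 + x.1 1 = u at *
  generalize (2 : ℝ) ^ i.1 = a at *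
  field_simp

theorem exists_hypNet_near (x : Hyperboloid 2) : ∃ i, -mink 2 (hypNet i).1 x.1 ≤ 5 / 2 := by
  have hx := x.zero_add_one_pos
  obtain ⟨l, hl1, hl2⟩ := exists_mem_Ico_zpow hx one_lt_two
  set r : ℝ := (x.1 0 + x.1 1) * 2 ^ (-l) with hr
  have hp : (0 : ℝ) < 2 ^ l := by positivity
  have hr1 : 1 ≤ r := by
    rw [hr, zpow_neg, ← div_eq_mul_inv, le_div_iff₀ hp]; linarith
  have hr2 : r ≤ 2 := by
    rw [zpow_add_one₀ two_ne_zero] at hl2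
    rw [hr, zpow_neg, ← div_eq_mul_inv, div_le_iff₀ hp]; linarith
  refine ⟨(-l, round (x.1 2 / r)), ?_⟩
  rw [neg_mink_hypNet]
  simp only [← hr]
  have h1 : r⁻¹ ≤ 1 := inv_le_one_of_one_le₀ hr1
  have h2 : ((round (x.1 2 / r) : ℝ) - x.1 2 / r) ^ 2 ≤ (1 / 2) ^ 2 := by
    rw [sq_le_sq, abs_sub_comm, abs_of_pos (by norm_num : (0 : ℝ) < 1 / 2)]
    exact abs_sub_round _
  nlinarith

theorem summable_inv_two_zpow_add : Summable fun j : ℤ => ((2 : ℝ) ^ j + (2 ^ j)⁻¹)⁻¹ := by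
  have key : ∀ n : ℕ, ((2 : ℝ) ^ n + (2 ^ n)⁻¹)⁻¹ ≤ (1 / 2) ^ n := by
    intro n
    rw [one_div, inv_pow]
    exact inv_anti₀ (by positivity) (le_add_of_nonneg_right (by positivity))
  rw [summable_int_iff_summable_nat_and_neg]
  constructor
  · refine Summable.of_nonneg_of_le (fun n => by positivity) (fun n => ?_)
      summable_geometric_two
    simpa using key n
  · refine Summable.of_nonneg_of_le (fun n => by positivity) (fun n => ?_)
      summable_geometric_two
    simpa [add_comm] using key n

theorem summable_inv_one_add_int_sq : Summable fun m : ℤ => (1 + (m : ℝ) ^ 2)⁻¹ := by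
  have key : Summable fun n : ℕ => (1 + (n : ℝ) ^ 2)⁻¹ := by
    have h := ((summable_nat_add_iff 1).2 (Real.summable_one_div_nat_pow.2 one_lt_two)).mul_left 2
    refine Summable.of_nonneg_of_le (fun n => by positivity) (fun n => ?_) h
    push_cast
    rw [mul_one_div, inv_eq_one_div, div_le_div_iff₀ (by positivity) (by positivity)]
    nlinarith [sq_nonneg ((n : ℝ) - 1)]
  rw [summable_int_iff_summable_nat_and_neg]
  constructor
  · simpa using key
  · simpa using key

/-- Uniform convergence of the Poincaré-type series `∑ (cosh d(y, x))⁻³` over the net. -/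
theorem exists_hypNet_series_bound : ∃ C : ℝ, ∀ x : Hyperboloid 2,
    Summable (fun i => ((-mink 2 (hypNet i).1 x.1) ^ 3)⁻¹) ∧
      ∑' i, ((-mink 2 (hypNet i).1 x.1) ^ 3)⁻¹ ≤ C := by
  have hG : Summable fun i : ℤ × ℤ =>
      48 * (((2 : ℝ) ^ i.1 + (2 ^ i.1)⁻¹)⁻¹ * (1 + (i.2 : ℝ) ^ 2)⁻¹) :=
    (summable_inv_two_zpow_add.mul_of_nonneg summable_inv_one_add_int_sq
      (fun j => by positivity) (fun m => by positivity)).mul_left 48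
  refine ⟨∑' i : ℤ × ℤ, 48 * (((2 : ℝ) ^ i.1 + (2 ^ i.1)⁻¹)⁻¹ * (1 + (i.2 : ℝ) ^ 2)⁻¹),
    fun x => ?_⟩
  have hx := x.zero_add_one_pos
  obtain ⟨l, hl1, hl2⟩ := exists_mem_Ico_zpow hx one_lt_two
  let α : ℤ → ℝ := fun j => x.1 2 / ((x.1 0 + x.1 1) * 2 ^ (j - l))
  let E : ℤ × ℤ ≃ ℤ × ℤ :=
    Equiv.prodShear (Equiv.subRight l) fun j => Equiv.addRight ⌊α j⌋
  have hE : ∀ i, E i = (i.1 - l, i.2 + ⌊α i.1⌋) := fun i => rfl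
  have hnn : ∀ i, 0 ≤ ((-mink 2 (hypNet i).1 x.1) ^ 3)⁻¹ := fun i => by
    have := (hypNet i).one_le_neg_mink x
    positivity
  have hle : ∀ i, ((-mink 2 (hypNet (E i)).1 x.1) ^ 3)⁻¹ ≤
      48 * (((2 : ℝ) ^ i.1 + (2 ^ i.1)⁻¹)⁻¹ * (1 + (i.2 : ℝ) ^ 2)⁻¹) := by
    rintro ⟨j, m⟩
    have hα : α j = x.1 2 / ((x.1 0 + x.1 1) * 2 ^ (j - l)) := rfl
    rw [neg_mink_hypNet, hE]
    simp only [← hα]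
    set r : ℝ := (x.1 0 + x.1 1) * 2 ^ (j - l) with hr
    have hj : (0 : ℝ) < 2 ^ j := by positivity
    have hp : (0 : ℝ) < 2 ^ l := by positivity
    have hr' : r = (x.1 0 + x.1 1) / 2 ^ l * 2 ^ j := by
      rw [hr, zpow_sub₀ two_ne_zero]; ring
    have hη1 : 1 ≤ (x.1 0 + x.1 1) / 2 ^ l := by rwa [one_le_div hp]
    have hη2 : (x.1 0 + x.1 1) / 2 ^ l ≤ 2 := by
      rw [zpow_add_one₀ two_ne_zero] at hl2
      rw [div_le_iff₀ hp]; linarith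
    have hr1 : 2 ^ j ≤ r := by rw [hr']; exact le_mul_of_one_le_left hj.le hη1
    have hr2 : r ≤ 2 * 2 ^ j := by rw [hr']; exact mul_le_mul_of_nonneg_right hη2 hj.le
    have hr0 : 0 < r := hj.trans_le hr1
    have hri : (2 ^ j : ℝ)⁻¹ / 2 ≤ r⁻¹ := by
      have := inv_anti₀ hr0 hr2
      rw [mul_inv] at this
      linarith
    push_cast
    have hf1 := Int.floor_le (α j)
    have hf2 := Int.lt_floor_add_one (α j)
    set δ : ℝ := m + ⌊α j⌋ - α j with hδ
    have hm : 1 + (m : ℝ) ^ 2 ≤ 3 * (1 + δ ^ 2) := by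
      nlinarith [sq_nonneg (δ - (α j - ⌊α j⌋)), sq_nonneg (α j - ⌊α j⌋)]
    have hi0 : 0 < r⁻¹ := by positivity
    have hρ : (2 ^ j + (2 ^ j : ℝ)⁻¹) ≤ 2 * (r + r⁻¹) := by linarith
    have hρ2 : 1 ≤ (r + r⁻¹) * r := by
      have : r⁻¹ * r = 1 := inv_mul_cancel₀ hr0.ne'
      nlinarith
    have hρr : r ≤ r + r⁻¹ := le_add_of_nonneg_right hi0.le
    have hρ3 : 0 < r + r⁻¹ := by positivity
    generalize r + r⁻¹ = ρ at *
    have hC0 : ρ ≤ ρ + r * δ ^ 2 := le_add_of_nonneg_right (by positivity)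
    have hC1 : 1 + δ ^ 2 ≤ ρ * (ρ + r * δ ^ 2) := by
      nlinarith [sq_nonneg δ, mul_le_mul_of_nonneg_right hρ2 (sq_nonneg δ),
        mul_le_mul_of_nonneg_left hρr hρ3.le]
    have hC2 : ρ * (1 + δ ^ 2) ≤ (ρ + r * δ ^ 2) ^ 3 := by
      calc ρ * (1 + δ ^ 2) ≤ ρ * (ρ * (ρ + r * δ ^ 2)) := by gcongr
        _ = ρ ^ 2 * (ρ + r * δ ^ 2) := by ring
        _ ≤ (ρ + r * δ ^ 2) ^ 2 * (ρ + r * δ ^ 2) := by gcongr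
        _ = _ := by ring
    have e : (48 : ℝ) * ((2 ^ j + (2 ^ j)⁻¹)⁻¹ * (1 + (m : ℝ) ^ 2)⁻¹) =
        ((2 ^ j + (2 ^ j)⁻¹) * (1 + (m : ℝ) ^ 2) / 48)⁻¹ := by
      rw [inv_div, div_eq_mul_inv, mul_inv]
    rw [e]
    refine inv_anti₀ (by positivity) ?_
    have hb : (2 ^ j + (2 ^ j : ℝ)⁻¹) * (1 + (m : ℝ) ^ 2) ≤ 2 * ρ * (3 * (1 + δ ^ 2)) := by
      gcongr
    rw [div_pow]
    linarith
  have hs : Summable fun i => ((-mink 2 (hypNet (E i)).1 x.1) ^ 3)⁻¹ :=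
    Summable.of_nonneg_of_le (fun i => hnn _) hle hG
  refine ⟨E.summable_iff.1 hs, ?_⟩
  rw [← E.tsum_eq]
  exact hs.tsum_le_tsum hle hG

/-! ### The quasi-inverse -/

/-- A quasi-isometric embedding of the hyperbolic plane into a metric space has a globally
defined Lipschitz quasi-inverse. -/
theorem exists_lipschitz_quasi_inverse {H2 X : Type*} [MetricSpace H2] [PseudoMetricSpace X]
    (hH2 : IsHyperbolicSpace 2 H2) (ι : H2 → X) (hι : QuasiIsometricEmbedding ι) :
    ∃ (f : X → H2) (K : ℝ≥0), LipschitzWith K f ∧ ∃ C : ℝ, ∀ x, dist (f (ι x)) x ≤ C := by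
  obtain ⟨e, he⟩ := hH2
  obtain ⟨Λ, a, hΛ, ha, hqi⟩ := hι
  obtain ⟨C, hC⟩ := exists_hypNet_series_bound
  have hΛ0 : 0 < Λ := by linarith
  let L : ℝ := 4 * Λ
  have hL : 0 < L := by positivity
  let w : X → ℤ × ℤ → ℝ := fun p i => Real.exp (-(L * dist p (ι (e.symm (hypNet i)))))
  have hw0 : ∀ p i, 0 < w p i := fun p i => Real.exp_pos _
  have hwle : ∀ p q i, w p i ≤ Real.exp (L * dist p q) * w q i := by
    intro p q i
    simp only [w]
    rw [← Real.exp_add, Real.exp_le_exp]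
    nlinarith [dist_triangle_left q (ι (e.symm (hypNet i))) p]
  have hdist : ∀ x i, dist x (e.symm (hypNet i)) = hypDist (hypNet i) (e x) := by
    intro x i
    rw [dist_comm, he, e.apply_symm_apply]
  have hwι : ∀ x i, w (ι x) i * -mink 2 (hypNet i).1 (e x).1 ≤
      Real.exp (L * a) * ((-mink 2 (hypNet i).1 (e x).1) ^ 3)⁻¹ := by
    intro x i
    have h1 := (hqi x (e.symm (hypNet i))).1
    rw [hdist] at h1
    have h2 := (hypNet i).one_le_neg_mink (e x)
    have h3 : -mink 2 (hypNet i).1 (e x).1 ≤ Real.exp (hypDist (hypNet i) (e x)) := by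
      rw [← Hyperboloid.cosh_hypDist, Real.cosh_eq]
      have := Real.exp_le_exp.2 (neg_le_self ((hypNet i).hypDist_nonneg (e x)))
      linarith
    have h4 : w (ι x) i ≤ Real.exp (L * a) * (Real.exp (hypDist (hypNet i) (e x)) ^ 4)⁻¹ := by
      simp only [w]
      rw [← Real.exp_nat_mul, ← Real.exp_neg, ← Real.exp_add, Real.exp_le_exp]
      have : L * (Λ⁻¹ * hypDist (hypNet i) (e x) - a) ≤
          L * dist (ι x) (ι (e.symm (hypNet i))) := mul_le_mul_of_nonneg_left h1 hL.le
      have e1 : L * (Λ⁻¹ * hypDist (hypNet i) (e x) - a) =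
          4 * hypDist (hypNet i) (e x) - L * a := by
        simp only [L]
        field_simp
      push_cast
      linarith
    generalize -mink 2 (hypNet i).1 (e x).1 = b at *
    have hb : 0 < b := by linarith
    calc w (ι x) i * b ≤ (Real.exp (L * a) * (b ^ 4)⁻¹) * b := by
          gcongr
          exact h4.trans (by gcongr)
      _ = _ := by field_simp
  let o : Hyperboloid 2 := ⟨![1, 0, 0], by
    refine ⟨?_, by simp⟩
    rw [← neg_inj, neg_mink_two]
    simp⟩
  have hsum : ∀ p, HypSummable hypNet (w p) := by
    have hbase : HypSummable hypNet (w (ι (e.symm o))) := by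
      refine ⟨fun i => (hw0 _ i).le, Summable.of_nonneg_of_le
        (fun i => mul_nonneg (hw0 _ i).le (hypNet i).zero_pos.le) (fun i => ?_)
        ((hC o).1.mul_left (Real.exp (L * a)))⟩
      have h := hwι (e.symm o) i
      rw [e.apply_symm_apply] at h
      have h0 : -mink 2 (hypNet i).1 o.1 = (hypNet i).1 0 := by
        rw [neg_mink_two]
        simp [o]
      rwa [h0] at h ⊢
    intro p
    exact hbase.mono (fun i => (hw0 p i).le) _ (hwle p _)
  have hpos : ∀ p, 0 < ∑' i, w p i := fun p =>
    (hsum p).summable.tsum_pos (fun i => (hw0 p i).le) 0 (hw0 p 0)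
  let F : X → Hyperboloid 2 := fun p => hypBarycenter hypNet (w p) (hsum p) (hpos p)
  refine ⟨fun p => e.symm (F p), L.toNNReal, ?_, ?_⟩
  · refine LipschitzWith.of_dist_le_mul fun p q => ?_
    rw [he, e.apply_symm_apply, e.apply_symm_apply, Real.coe_toNNReal _ hL.le]
    refine hypDist_hypBarycenter_le (hsum p) (hsum q) (hpos p) (hpos q)
      (mul_nonneg hL.le dist_nonneg) (fun i => ?_) (hwle p q)
    rw [dist_comm]
    exact hwle q p i
  · let δ : ℝ := Real.exp (-(L * (Λ * Real.arcosh (5 / 2) + a)))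
    have hδ : 0 < δ := Real.exp_pos _
    refine ⟨Real.arcosh (Real.exp (L * a) * C / δ), fun x => ?_⟩
    rw [he, e.apply_symm_apply]
    have hnum : -mink 2 (hypSum hypNet (w (ι x))) (e x).1 ≤ Real.exp (L * a) * C :=
      (hasSum_le (hwι x) ((hsum (ι x)).hasSum_neg_mink (e x).1)
        ((hC (e x)).1.hasSum.mul_left _)).trans
          (mul_le_mul_of_nonneg_left (hC (e x)).2 (Real.exp_pos _).le)
    have hden : δ ≤ √(-mink 2 (hypSum hypNet (w (ι x))) (hypSum hypNet (w (ι x)))) := by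
      refine le_trans ?_ (hsum (ι x)).tsum_le_sqrt
      obtain ⟨i, hi⟩ := exists_hypNet_near (e x)
      refine le_trans ?_ ((hsum (ι x)).summable.le_tsum i fun j _ => (hw0 _ j).le)
      simp only [w, δ]
      rw [Real.exp_le_exp]
      have h1 := (hqi x (e.symm (hypNet i))).2
      have h2 : hypDist (hypNet i) (e x) ≤ Real.arcosh (5 / 2) := by
        refine Hyperboloid.hypDist_le (Real.arcosh_nonneg (by norm_num)) ?_
        rwa [Real.cosh_arcosh (by norm_num)]
      rw [hdist] at h1
      have h3 := h1.trans (add_le_add_left (mul_le_mul_of_nonneg_left h2 hΛ0.le) a)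
      exact neg_le_neg (mul_le_mul_of_nonneg_left h3 hL.le)
    have hle : -mink 2 (F (ι x)).1 (e x).1 ≤ Real.exp (L * a) * C / δ := by
      simp only [F, hypBarycenter]
      rw [Hyperboloid.neg_mink_normalize_left]
      have h0 : 0 ≤ -mink 2 (hypSum hypNet (w (ι x))) (e x).1 :=
        (hpos _).le.trans ((hsum (ι x)).tsum_le_neg_mink (e x))
      exact div_le_div₀ (h0.trans hnum) hnum hδ hden
    have h1 := ((F (ι x)).one_le_neg_mink (e x)).trans hle
    refine Hyperboloid.hypDist_le (Real.arcosh_nonneg h1) ?_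
    rwa [Real.cosh_arcosh h1]

/-- the Claim in §5.3. Let `ι : ℍ² → ℍⁿ` be a quasi-isometric
embedding, `S ⊆ ∂_∞ℍⁿ` the image of the induced boundary map (equivalently, the limit
set of `ι(ℍ²)`), and `K = CH(S)`.  For all `d` large enough there is a Lipschitz map
`f : N_d(K) → ℍ²` with `sup_{x ∈ ℍ²} dist (f (ι x)) x < ∞`. -/
theorem lipschitz_quasi_inverse_on_hull_neighborhood
    (n : ℕ) (H2 Hn : Type) [MetricSpace H2] [MetricSpace Hn]
    (hH2 : IsHyperbolicSpace 2 H2) (hHn : IsHyperbolicSpace n Hn)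
    (Bd : BoundaryAtInfinity Hn)
    (ι : H2 → Hn) (hι : QuasiIsometricEmbedding ι) :
    ∃ d₀ : ℝ, ∀ d : ℝ, d₀ ≤ d →
      ∃ (f : Hn → H2) (Lc : ℝ≥0),
        LipschitzOnWith Lc f
          (cthickening d
            (Bd.CH {ζ : Bd.pt | ∃ u : ℕ → H2, Bd.conv (fun k => ι (u k)) ζ})) ∧
        ∃ C : ℝ, ∀ x : H2, dist (f (ι x)) x ≤ C := by
  obtain ⟨f, K, hf, hC⟩ := exists_lipschitz_quasi_inverse hH2 ι hι
  exact ⟨0, fun d _ => ⟨f, K, hf.lipschitzOnWith, hC⟩⟩
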